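/- arXiv:1712.07731 — 7 statements merged into one kernel-verified Lean document; each statement's English description precedes it below -/
import Mathlib

section
/- Let p > 0 and s > 0. The function f(t) = t^s satisfies the inequality (α A^p + (1-α) B^p)^{s/p} ≤ α A^s + (1-α) B^s for all positive definite matrices A, B (of any order) and all α ∈ (0,1) if and only if s/p ∈ [1,2], i.e. p ≤ s ≤ 2p. Equivalently, with h(α) = α, the function t^s is operator (p,h)-convex if and only if s ∈ [p, 2p]. -/
open Matrix
open scoped ComplexOrder

/-- The matrix `A` raised to the real power `p`, defined via the continuous
functional calculus (using the real power function `Real.rpow`). -/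
noncomputable def mpow {n : ℕ} (A : Matrix (Fin n) (Fin n) ℂ) (p : ℝ) :
    Matrix (Fin n) (Fin n) ℂ :=
  cfc (fun x : ℝ => x ^ p) A

/-- The Loewner order on matrices: `loewnerLE X Y` iff `Y - X` is positive semidefinite. -/
def loewnerLE {n : ℕ} (X Y : Matrix (Fin n) (Fin n) ℂ) : Prop :=
  (Y - X).PosSemidef

/-- A set `K ⊆ ℝ` is `p`-convex if `(l*x^p + (1-l)*y^p)^(1/p) ∈ K` for all
`x, y ∈ K` and `l ∈ [0,1]`. -/
def PConvex (p : ℝ) (K : Set ℝ) : Prop :=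
  ∀ x ∈ K, ∀ y ∈ K, ∀ l ∈ Set.Icc (0 : ℝ) 1,
    (l * x ^ p + (1 - l) * y ^ p) ^ (1 / p) ∈ K

/-- `h` is super-multiplicative on `J`: `h (x*y) ≥ h x * h y` for all `x, y ∈ J`. -/
def SuperMultiplicativeOn (J : Set ℝ) (h : ℝ → ℝ) : Prop :=
  ∀ x ∈ J, ∀ y ∈ J, h x * h y ≤ h (x * y)

/-- `f` is operator `(p,h)`-convex on `K`: `f` is nonnegative and continuous on `K`, and
`f([α A^p + (1-α) B^p]^{1/p}) ≤ h(α) f(A) + h(1-α) f(B)` (in the Loewner order) for all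
positive semidefinite matrices `A, B` (of any order `n`) with spectra in `K` and all
`α ∈ (0,1)`, where matrix functions are taken via the continuous functional calculus. -/
def OperatorPHConvexOn (p : ℝ) (K : Set ℝ) (h : ℝ → ℝ) (f : ℝ → ℝ) : Prop :=
  (∀ x ∈ K, 0 ≤ f x) ∧ ContinuousOn f K ∧
  ∀ (n : ℕ) (A B : Matrix (Fin n) (Fin n) ℂ),
    A.PosSemidef → B.PosSemidef → spectrum ℝ A ⊆ K → spectrum ℝ B ⊆ K →
    ∀ α ∈ Set.Ioo (0 : ℝ) 1,
      loewnerLE (cfc f (mpow (α • mpow A p + (1 - α) • mpow B p) (1 / p)))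
        (h α • cfc f A + h (1 - α) • cfc f B)

section

open scoped MatrixOrder

variable {n : ℕ} {X Y : Matrix (Fin n) (Fin n) ℂ}

theorem Matrix.continuousOn_spectrum (f : ℝ → ℝ) (X : Matrix (Fin n) (Fin n) ℂ) :
    ContinuousOn f (spectrum ℝ X) :=
  X.finite_real_spectrum.continuousOn f

theorem Matrix.PosDef.pos_of_mem_spectrum (hX : X.PosDef) {x : ℝ} (hx : x ∈ spectrum ℝ X) :
    0 < x :=
  hX.isStrictlyPositive.spectrum_pos hx

theorem mpow_mul_mpow (hX : X.PosDef) (a b : ℝ) : mpow X a * mpow X b = mpow X (a + b) := by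
  unfold mpow
  rw [← cfc_mul _ _ X (X.continuousOn_spectrum _) (X.continuousOn_spectrum _)]
  exact cfc_congr fun x hx => (Real.rpow_add (hX.pos_of_mem_spectrum hx) a b).symm

theorem mpow_one (hX : X.PosDef) : mpow X 1 = X := by
  simpa [mpow] using cfc_id' ℝ X hX.1.isSelfAdjoint

theorem mpow_zero (hX : X.PosDef) : mpow X 0 = 1 := by
  simpa [mpow] using cfc_const_one ℝ X hX.1.isSelfAdjoint

theorem mpow_mpow (hX : X.PosDef) (a b : ℝ) : mpow (mpow X a) b = mpow X (a * b) := by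
  unfold mpow
  rw [← cfc_comp _ _ X hX.1.isSelfAdjoint ((X.finite_real_spectrum.image _).continuousOn _)
    (X.continuousOn_spectrum _)]
  exact cfc_congr fun x hx => (Real.rpow_mul (hX.pos_of_mem_spectrum hx).le a b).symm

theorem mpow_posDef (hX : X.PosDef) (a : ℝ) : (mpow X a).PosDef := by
  have hnonneg : 0 ≤ mpow X a :=
    cfc_nonneg fun x hx => Real.rpow_nonneg (hX.pos_of_mem_spectrum hx).le a
  refine (Matrix.PosSemidef.posDef_iff_isUnit (Matrix.nonneg_iff_posSemidef.1 hnonneg)).2 ?_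
  exact .of_mul_eq_one (mpow X (-a)) (by rw [mpow_mul_mpow hX, add_neg_cancel, mpow_zero hX])

theorem mul_inv_mpow_mul (hX : X.PosDef) (r : ℝ) : X * (mpow X (2 - r))⁻¹ * X = mpow X r := by
  have hinv : (mpow X (2 - r))⁻¹ = mpow X (r - 2) := Matrix.inv_eq_right_inv <| by
    rw [mpow_mul_mpow hX, sub_add_sub_cancel, sub_self, mpow_zero hX]
  calc X * (mpow X (2 - r))⁻¹ * X = mpow X 1 * mpow X (r - 2) * mpow X 1 := by
        rw [hinv, mpow_one hX]
    _ = mpow X r := by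
        rw [mpow_mul_mpow hX, mpow_mul_mpow hX]
        congr 1
        ring

open scoped Matrix.Norms.L2Operator in
/-- Operator concavity of `t ↦ t ^ q` for `q ∈ [0, 1]`. -/
theorem loewnerLE_mpow_of_mem_Icc_zero_one (hX : X.PosSemidef) (hY : Y.PosSemidef) {q α : ℝ}
    (hq : q ∈ Set.Icc (0 : ℝ) 1) (hα : α ∈ Set.Ioo (0 : ℝ) 1) :
    loewnerLE (α • mpow X q + (1 - α) • mpow Y q) (mpow (α • X + (1 - α) • Y) q) := by
  have hβ : 0 ≤ 1 - α := by linarith [hα.2]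
  have hX' := Matrix.nonneg_iff_posSemidef.2 hX
  have hY' := Matrix.nonneg_iff_posSemidef.2 hY
  have h := (CFC.concaveOn_rpow (A := Matrix (Fin n) (Fin n) ℂ) hq).2 hX' hY' hα.1.le hβ (by ring)
  have hM : 0 ≤ α • X + (1 - α) • Y :=
    Matrix.nonneg_iff_posSemidef.2 ((hX.smul hα.1.le).add (hY.smul hβ))
  simp only [CFC.rpow_eq_cfc_real hX', CFC.rpow_eq_cfc_real hY', CFC.rpow_eq_cfc_real hM] at h
  exact Matrix.le_iff.1 h

theorem fromBlocks_posSemidef_iff_loewnerLE (hX : X.PosDef) (r : ℝ)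
    (W : Matrix (Fin n) (Fin n) ℂ) :
    (fromBlocks (mpow X (2 - r)) X X W).PosSemidef ↔ loewnerLE (mpow X r) W := by
  have hZ := mpow_posDef hX (2 - r)
  have := hZ.isUnit.invertible
  have h := hZ.fromBlocks₁₁ X W
  rwa [hX.1.eq, mul_inv_mpow_mul hX] at h

theorem fromBlocks_zero_posSemidef (hX : X.PosSemidef) :
    (fromBlocks X 0 0 (0 : Matrix (Fin n) (Fin n) ℂ)).PosSemidef := by
  have h := hX.conjTranspose_mul_mul_same (fromCols (1 : Matrix (Fin n) (Fin n) ℂ)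
    (0 : Matrix (Fin n) (Fin n) ℂ))
  simpa [conjTranspose_fromCols_eq_fromRows_conjTranspose, fromRows_mul, mul_fromCols,
    ← fromCols_fromRows_eq_fromBlocks] using h

/-- Operator convexity of `t ↦ t ^ r` for `r ∈ [1, 2]`: the Schur complement turns it into
operator concavity of `t ↦ t ^ (2 - r)`. -/
theorem mpow_loewnerLE_of_mem_Icc_one_two (hX : X.PosDef) (hY : Y.PosDef) {r α : ℝ}
    (hr : r ∈ Set.Icc (1 : ℝ) 2) (hα : α ∈ Set.Ioo (0 : ℝ) 1) :
    loewnerLE (mpow (α • X + (1 - α) • Y) r) (α • mpow X r + (1 - α) • mpow Y r) := by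
  have hβ : 0 < 1 - α := by linarith [hα.2]
  have hself (Z : Matrix (Fin n) (Fin n) ℂ) : loewnerLE Z Z := by
    simpa [loewnerLE] using Matrix.PosSemidef.zero
  rw [← fromBlocks_posSemidef_iff_loewnerLE ((hX.smul hα.1).add (hY.smul hβ))]
  have hconcave := fromBlocks_zero_posSemidef <|
    loewnerLE_mpow_of_mem_Icc_zero_one hX.posSemidef hY.posSemidef (q := 2 - r)
      ⟨by linarith [hr.2], by linarith [hr.1]⟩ hα
  have hsum := (((fromBlocks_posSemidef_iff_loewnerLE hX r _).2 (hself _)).smul hα.1.le).add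
    (((fromBlocks_posSemidef_iff_loewnerLE hY r _).2 (hself _)).smul hβ.le)
  simpa [fromBlocks_smul, fromBlocks_add] using hconcave.add hsum

/-- A function of a Hermitian matrix annihilated by a quadratic polynomial is given by linear
interpolation. -/
theorem mpow_eq_of_quadratic (hX : X.IsHermitian) {a b : ℝ} (hab : a ≠ b)
    (h : (X - a • 1) * (X - b • 1) = 0) (r : ℝ) :
    mpow X r = a ^ r • 1 + ((b ^ r - a ^ r) / (b - a)) • (X - a • 1) := by
  have hba : b - a ≠ 0 := sub_ne_zero.2 hab.symm
  have hspec : ∀ x ∈ spectrum ℝ X, x = a ∨ x = b := by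
    intro x hx
    by_contra! hne
    have hxa := sub_ne_zero.2 hne.1
    have hxb := sub_ne_zero.2 hne.2
    refine hx ?_
    have hmul : (x • (1 : Matrix (Fin n) (Fin n) ℂ) - X) *
        (((x - a) * (x - b))⁻¹ • (X + (x - a - b) • 1)) = 1 := by
      have hX2 : X * X = (a + b) • X - (a * b) • 1 := by
        simp only [sub_mul, mul_sub, smul_mul_assoc, mul_smul_comm, one_mul, mul_one] at h
        rw [← sub_eq_zero, ← h]
        module
      have : (x • (1 : Matrix (Fin n) (Fin n) ℂ) - X) * (X + (x - a - b) • 1)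
          = ((x - a) * (x - b)) • 1 := by
        simp only [sub_mul, mul_add, smul_mul_assoc, mul_smul_comm, one_mul, mul_one, hX2]
        module
      rw [mul_smul_comm, this, smul_smul, inv_mul_cancel₀ (mul_ne_zero hxa hxb), one_smul]
    rw [spectrum.mem_resolventSet_iff, Algebra.algebraMap_eq_smul_one]
    exact .of_mul_eq_one _ hmul
  have hcongr : mpow X r = cfc (fun x : ℝ => a ^ r + ((b ^ r - a ^ r) / (b - a)) * (x - a)) X := by
    refine cfc_congr fun x hx => ?_
    obtain rfl | rfl := hspec x hx
    · simp
    · field_simp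
      ring
  have hX' : IsSelfAdjoint X := hX
  rw [hcongr, cfc_const_add _ _ X, cfc_const_mul _ _ X, cfc_sub _ _ X, cfc_id' ℝ X, cfc_const a X]
  simp only [Algebra.algebraMap_eq_smul_one]

theorem mpow_smul_one {c : ℝ} (r : ℝ) :
    mpow (c • (1 : Matrix (Fin n) (Fin n) ℂ)) r = c ^ r • 1 := by
  simp only [mpow, ← Algebra.algebraMap_eq_smul_one]
  exact cfc_algebraMap c _

theorem one_le_of_mpow_loewnerLE {r : ℝ} (hr : 0 < r)
    (h : ∀ X Y : Matrix (Fin 1) (Fin 1) ℂ, X.PosDef → Y.PosDef → ∀ α ∈ Set.Ioo (0 : ℝ) 1,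
      loewnerLE (mpow (α • X + (1 - α) • Y) r) (α • mpow X r + (1 - α) • mpow Y r)) :
    1 ≤ r := by
  by_contra! hr1
  have hconcave : 1 / 2 * (1 : ℝ) ^ r + (1 - 1 / 2) * 2 ^ r <
      (1 / 2 * 1 + (1 - 1 / 2) * 2) ^ r :=
    (Real.strictConcaveOn_rpow hr hr1).2 (by simp) (by simp) (by norm_num) (by norm_num)
      (by norm_num) (by norm_num)
  have hle := h ((1 : ℝ) • 1) ((2 : ℝ) • 1) (Matrix.PosDef.one.smul one_pos)
    (Matrix.PosDef.one.smul two_pos) (1 / 2) ⟨by norm_num, by norm_num⟩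
  simp only [smul_smul, ← add_smul, mpow_smul_one, loewnerLE, ← sub_smul] at hle
  have hentry := hle.diag_nonneg (i := 0)
  simp only [Matrix.smul_apply, one_apply_eq, Complex.real_smul, mul_one,
    Complex.zero_le_real] at hentry hconcave
  linarith

theorem half_rpow_le_of_mpow_loewnerLE {r τ : ℝ} (hr : 0 < r) (hτ : τ ∈ Set.Ioo (0 : ℝ) 1)
    (h : ∀ X Y : Matrix (Fin 2) (Fin 2) ℂ, X.PosDef → Y.PosDef → ∀ α ∈ Set.Ioo (0 : ℝ) 1,
      loewnerLE (mpow (α • X + (1 - α) • Y) r) (α • mpow X r + (1 - α) • mpow Y r)) :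
    (1 / 2) ^ r / 2 ≤ (1 / 2 + (1 + 3 ^ r) / 4) * τ ^ (r - 2) := by
  obtain ⟨hτ0, hτ1⟩ := hτ
  let X : Matrix (Fin 2) (Fin 2) ℂ := !![1, 0; 0, (τ : ℂ) ^ 2]
  let Y : Matrix (Fin 2) (Fin 2) ℂ := !![2 * (τ : ℂ), (τ : ℂ); (τ : ℂ), 2 * (τ : ℂ)]
  let M : Matrix (Fin 2) (Fin 2) ℂ := (1 / 2 : ℝ) • X + (1 - 1 / 2 : ℝ) • Y
  have hX : X.PosDef := by
    have hdiag : X = diagonal ![1, (τ : ℂ) ^ 2] := by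
      ext i j; fin_cases i <;> fin_cases j <;> simp [X]
    rw [hdiag, posDef_diagonal_iff]
    intro i
    fin_cases i
    · simp
    · simpa [← Complex.ofReal_pow] using pow_pos hτ0 2
  have hY : Y.PosDef := by
    have hsum : Y = τ • (1 + vecMulVec 1 (star 1)) := by
      ext i j
      fin_cases i <;> fin_cases j <;> simp [Y, one_add_one_eq_two, mul_comm]
    rw [hsum]
    exact (Matrix.PosDef.one.add_posSemidef (posSemidef_vecMulVec_self_star _)).smul hτ0
  have hM : M.PosDef := (hX.smul (by norm_num)).add (hY.smul (by norm_num))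
  have hXr : mpow X r = _ := mpow_eq_of_quadratic hX.1 (a := τ ^ 2) (b := 1) (by nlinarith) (by
    ext i j; fin_cases i <;> fin_cases j <;> simp [X, Matrix.mul_apply, Fin.sum_univ_two]) r
  have hYr : mpow Y r = _ := mpow_eq_of_quadratic hY.1 (a := τ) (b := 3 * τ) (by linarith) (by
    ext i j
    fin_cases i <;> fin_cases j <;> simp [Y, Matrix.mul_apply, Fin.sum_univ_two] <;> ring) r
  have hMr : mpow M r = _ := mpow_eq_of_quadratic hM.1 (a := τ) (b := τ + (1 + τ ^ 2) / 2)
    (by nlinarith) (by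
      ext i j
      fin_cases i <;> fin_cases j <;> simp [M, X, Y, Matrix.mul_apply, Fin.sum_univ_two] <;> ring) r
  have hentry := (h X Y hX hY (1 / 2) ⟨by norm_num, by norm_num⟩).diag_nonneg (i := 1)
  change 0 ≤ ((1 / 2 : ℝ) • mpow X r + (1 - 1 / 2 : ℝ) • mpow Y r - mpow M r) 1 1 at hentry
  rw [hXr, hYr, hMr] at hentry
  set b := τ + (1 + τ ^ 2) / 2 with hb
  have hreal : 0 ≤ 1 / 2 * (τ ^ 2) ^ r +
      (1 - 1 / 2) * (τ ^ r + ((3 * τ) ^ r - τ ^ r) / (3 * τ - τ) * τ)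
      - (τ ^ r + (b ^ r - τ ^ r) / (b - τ) * (τ ^ 2 / 2)) := by
    rw [← Complex.zero_le_real]
    convert hentry using 1
    simp [M, X, Y]
    ring
  have hslopeY : ((3 * τ) ^ r - τ ^ r) / (3 * τ - τ) * τ = (3 ^ r - 1) * τ ^ r / 2 := by
    rw [Real.mul_rpow (by norm_num) hτ0.le]
    field_simp
    ring
  have hslopeM : (b ^ r - τ ^ r) / (b - τ) * (τ ^ 2 / 2) =
      (b ^ r - τ ^ r) * (τ ^ 2 / (1 + τ ^ 2)) := by
    rw [hb, add_sub_cancel_left]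
    field_simp
  have hsq : (τ ^ 2) ^ r ≤ τ ^ r :=
    Real.rpow_le_rpow (by positivity) (by nlinarith) hr.le
  have hb_half : (1 / 2 : ℝ) ^ r ≤ b ^ r :=
    Real.rpow_le_rpow (by norm_num) (by nlinarith) hr.le
  have hratio : τ ^ 2 / 2 ≤ τ ^ 2 / (1 + τ ^ 2) := by gcongr; nlinarith
  have hratio_le : τ ^ 2 / (1 + τ ^ 2) ≤ 1 := (div_le_one (by positivity)).2 (by linarith)
  have hlower : (1 / 2) ^ r * (τ ^ 2 / 2) ≤ b ^ r * (τ ^ 2 / (1 + τ ^ 2)) := by gcongr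
  have hτr : 0 < τ ^ r := by positivity
  have hdrop := mul_le_mul_of_nonneg_left hratio_le hτr.le
  rw [hslopeY, hslopeM] at hreal
  rw [Real.rpow_sub hτ0, Real.rpow_two, ← mul_div_assoc, le_div_iff₀ (by positivity)]
  linarith

theorem le_two_of_mpow_loewnerLE {r : ℝ} (hr : 0 < r)
    (h : ∀ X Y : Matrix (Fin 2) (Fin 2) ℂ, X.PosDef → Y.PosDef → ∀ α ∈ Set.Ioo (0 : ℝ) 1,
      loewnerLE (mpow (α • X + (1 - α) • Y) r) (α • mpow X r + (1 - α) • mpow Y r)) :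
    r ≤ 2 := by
  by_contra! hr2
  have hlim := ((Real.continuousAt_rpow_const 0 (r - 2) (.inr (by linarith))).tendsto.mono_left
    (nhdsWithin_le_nhds (s := Set.Ioi 0))).const_mul (1 / 2 + (1 + (3 : ℝ) ^ r) / 4)
  have hle := ge_of_tendsto hlim <| Filter.mem_of_superset (Ioo_mem_nhdsGT one_pos)
    fun τ hτ => half_rpow_le_of_mpow_loewnerLE hr hτ h
  rw [Real.zero_rpow (by linarith), mul_zero] at hle
  have : (0 : ℝ) < (1 / 2) ^ r := by positivity
  linarith

end

/-- Let `p > 0`, `s > 0`. The function `f(t) = t^s` satisfies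
`(α A^p + (1-α) B^p)^{s/p} ≤ α A^s + (1-α) B^s` for all positive definite matrices
`A, B` (of any order) and all `α ∈ (0,1)` if and only if `s/p ∈ [1,2]`,
i.e. `p ≤ s ≤ 2p`. -/
theorem stmt0 (p s : ℝ) (hp : 0 < p) (hs : 0 < s) :
    (∀ (n : ℕ) (A B : Matrix (Fin n) (Fin n) ℂ), A.PosDef → B.PosDef →
      ∀ α ∈ Set.Ioo (0 : ℝ) 1,
        loewnerLE (mpow (α • mpow A p + (1 - α) • mpow B p) (s / p))
          (α • mpow A s + (1 - α) • mpow B s))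
    ↔ s ∈ Set.Icc p (2 * p) := by
  have hpow {n : ℕ} {X : Matrix (Fin n) (Fin n) ℂ} (hX : X.PosDef) (q : ℝ) :
      mpow (mpow X (1 / p)) q = mpow X (q / p) := by
    rw [mpow_mpow hX, one_div_mul_eq_div]
  rw [Set.mem_Icc, ← one_le_div hp, ← div_le_iff₀ hp]
  constructor
  · intro h
    have h' (n : ℕ) (X Y : Matrix (Fin n) (Fin n) ℂ) (hX : X.PosDef) (hY : Y.PosDef)
        (α : ℝ) (hα : α ∈ Set.Ioo (0 : ℝ) 1) :
        loewnerLE (mpow (α • X + (1 - α) • Y) (s / p))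
          (α • mpow X (s / p) + (1 - α) • mpow Y (s / p)) := by
      have h1 := h n _ _ (mpow_posDef hX (1 / p)) (mpow_posDef hY (1 / p)) α hα
      simpa only [hpow hX, hpow hY, div_self hp.ne', mpow_one hX, mpow_one hY] using h1
    have hr := div_pos hs hp
    exact ⟨one_le_of_mpow_loewnerLE hr (h' 1), le_two_of_mpow_loewnerLE hr (h' 2)⟩
  · intro hr n A B hA hB α hα
    have h1 := mpow_loewnerLE_of_mem_Icc_one_two (mpow_posDef hA p) (mpow_posDef hB p) hr hα
    simpa only [mpow_mpow hA, mpow_mpow hB, mul_div_cancel₀ s hp.ne'] using h1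
end

section
/- Let 1 ≤ p₁ ≤ p₂, K ⊆ ℝ⁺ an interval, and h a nonnegative non-zero function on an interval J ⊆ ℝ⁺ containing (0,1). If f is operator (p₂,h)-convex on K and f is operator monotone on K, then f is operator (p₁,h)-convex on K. -/
open Matrix
open scoped ComplexOrder

/-- `f` is operator monotone on `K`: `A ≤ B` (Loewner order) implies `f(A) ≤ f(B)` for all
Hermitian matrices `A, B` (of any order) with spectra in `K`. -/
def OperatorMonotoneOn (K : Set ℝ) (f : ℝ → ℝ) : Prop :=
  ∀ (n : ℕ) (A B : Matrix (Fin n) (Fin n) ℂ), A.IsHermitian → B.IsHermitian →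
    spectrum ℝ A ⊆ K → spectrum ℝ B ⊆ K → loewnerLE A B → loewnerLE (cfc f A) (cfc f B)

section CStarAlgebra

variable {A : Type*} [CStarAlgebra A] [PartialOrder A] [StarOrderedRing A]

/-- The weighted power mean `(α a ^ p + (1 - α) b ^ p) ^ (1 / p)` of nonnegative elements of a
C⋆-algebra is monotone in `p ∈ [1, ∞)`. -/
lemma CFC.rpow_mean_le_rpow_mean {p q : ℝ} (hp : 1 ≤ p) (hpq : p ≤ q) {a b : A}
    (ha : 0 ≤ a) (hb : 0 ≤ b) {α : ℝ} (hα : α ∈ Set.Icc (0 : ℝ) 1) :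
    (α • a ^ p + (1 - α) • b ^ p) ^ (1 / p) ≤ (α • a ^ q + (1 - α) • b ^ q) ^ (1 / q) := by
  have hp0 : 0 < p := by linarith
  have hq0 : 0 < q := by linarith
  have hα' : 0 ≤ 1 - α := sub_nonneg.2 hα.2
  have hpow : ∀ c : A, 0 ≤ c → (c ^ q) ^ (p / q) = c ^ p := fun c hc => by
    rw [CFC.rpow_rpow_of_exponent_nonneg c q (p / q) hq0.le (by positivity) hc,
      mul_div_cancel₀ _ hq0.ne']
  have hconc := (CFC.concaveOn_rpow (A := A) (p := p / q)
    ⟨by positivity, (div_le_one hq0).2 hpq⟩).2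
    (x := a ^ q) CFC.rpow_nonneg (y := b ^ q) CFC.rpow_nonneg hα.1 hα' (by ring)
  simp only [hpow a ha, hpow b hb] at hconc
  have hS : 0 ≤ α • a ^ q + (1 - α) • b ^ q :=
    add_nonneg (smul_nonneg hα.1 CFC.rpow_nonneg) (smul_nonneg hα' CFC.rpow_nonneg)
  refine (CFC.rpow_le_rpow ⟨by positivity, (div_le_one hp0).2 hp⟩ hconc).trans_eq ?_
  rw [CFC.rpow_rpow_of_exponent_nonneg _ (p / q) (1 / p) (by positivity) (by positivity) hS]
  congr 1
  field_simp

/-- The spectrum of a weighted power mean lies in any interval of nonnegative reals containing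
the spectra of both elements. -/
lemma CFC.spectrum_rpow_mean_subset [Nontrivial A] {p : ℝ} (hp : 0 < p) {a b : A}
    (ha : 0 ≤ a) (hb : 0 ≤ b) {α : ℝ} (hα : α ∈ Set.Icc (0 : ℝ) 1) {K : Set ℝ}
    (hK : K.OrdConnected) (haK : spectrum ℝ a ⊆ K) (hbK : spectrum ℝ b ⊆ K) :
    spectrum ℝ ((α • a ^ p + (1 - α) • b ^ p) ^ (1 / p)) ⊆ K := by
  have hα' : 0 ≤ 1 - α := sub_nonneg.2 hα.2
  have hS : 0 ≤ α • a ^ p + (1 - α) • b ^ p :=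
    add_nonneg (smul_nonneg hα.1 CFC.rpow_nonneg) (smul_nonneg hα' CFC.rpow_nonneg)
  have hcompact : IsCompact (spectrum ℝ a ∪ spectrum ℝ b) :=
    (spectrum.isCompact a).union (spectrum.isCompact b)
  have hne : (spectrum ℝ a ∪ spectrum ℝ b).Nonempty :=
    (ContinuousFunctionalCalculus.spectrum_nonempty (R := ℝ) (p := IsSelfAdjoint) a
      ha.isSelfAdjoint).inl
  have hnn : ∀ x ∈ spectrum ℝ a ∪ spectrum ℝ b, 0 ≤ x := by
    rintro x (hx | hx)
    exacts [spectrum_nonneg_of_nonneg ha hx, spectrum_nonneg_of_nonneg hb hx]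
  obtain ⟨m, hm, hmin⟩ := hcompact.exists_isLeast hne
  obtain ⟨M, hM, hmax⟩ := hcompact.exists_isGreatest hne
  have hm0 := hnn m hm
  have hM0 := hnn M hM
  have hbounds : ∀ c : A, 0 ≤ c → spectrum ℝ c ⊆ spectrum ℝ a ∪ spectrum ℝ b →
      algebraMap ℝ A (m ^ p) ≤ c ^ p ∧ c ^ p ≤ algebraMap ℝ A (M ^ p) := by
    intro c hc hsub
    have hcont : ContinuousOn (fun x : ℝ => x ^ p) (spectrum ℝ c) :=
      (Real.continuous_rpow_const hp.le).continuousOn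
    rw [CFC.rpow_eq_cfc_real hc]
    refine ⟨algebraMap_le_cfc _ _ c fun x hx => ?_, cfc_le_algebraMap _ _ c fun x hx => ?_⟩
    · exact Real.rpow_le_rpow hm0 (hmin (hsub hx)) hp.le
    · exact Real.rpow_le_rpow (hnn x (hsub hx)) (hmax (hsub hx)) hp.le
  obtain ⟨ha₁, ha₂⟩ := hbounds a ha Set.subset_union_left
  obtain ⟨hb₁, hb₂⟩ := hbounds b hb Set.subset_union_right
  have hcomb : ∀ t : ℝ, algebraMap ℝ A t = α • algebraMap ℝ A t + (1 - α) • algebraMap ℝ A t :=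
    fun t => by rw [← add_smul, add_sub_cancel, one_smul]
  have hlow : algebraMap ℝ A (m ^ p) ≤ α • a ^ p + (1 - α) • b ^ p := by
    rw [hcomb]
    exact add_le_add (smul_le_smul_of_nonneg_left ha₁ hα.1) (smul_le_smul_of_nonneg_left hb₁ hα')
  have hup : α • a ^ p + (1 - α) • b ^ p ≤ algebraMap ℝ A (M ^ p) := by
    rw [hcomb]
    exact add_le_add (smul_le_smul_of_nonneg_left ha₂ hα.1) (smul_le_smul_of_nonneg_left hb₂ hα')
  rw [algebraMap_le_iff_le_spectrum (ha := hS.isSelfAdjoint)] at hlow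
  rw [le_algebraMap_iff_spectrum_le (ha := hS.isSelfAdjoint)] at hup
  rw [CFC.rpow_eq_cfc_real hS, cfc_map_spectrum (fun x : ℝ => x ^ (1 / p)) _ hS.isSelfAdjoint
    (Real.continuous_rpow_const (by positivity)).continuousOn]
  rintro _ ⟨x, hx, rfl⟩
  have hroot : ∀ t : ℝ, 0 ≤ t → (t ^ p) ^ (1 / p) = t := fun t ht => by
    rw [one_div, Real.rpow_rpow_inv ht hp.ne']
  refine hK.out (Set.union_subset haK hbK hm) (Set.union_subset haK hbK hM) ⟨?_, ?_⟩
  · rw [← hroot m hm0]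
    exact Real.rpow_le_rpow (by positivity) (hlow x hx) (by positivity)
  · rw [← hroot M hM0]
    exact Real.rpow_le_rpow (spectrum_nonneg_of_nonneg hS hx) (hup x hx) (by positivity)

end CStarAlgebra

section Matrix

open scoped Matrix.Norms.L2Operator MatrixOrder

variable {n : ℕ} {A B : Matrix (Fin n) (Fin n) ℂ}

lemma mpow_eq_rpow (hA : 0 ≤ A) (p : ℝ) : mpow A p = A ^ p :=
  (CFC.rpow_eq_cfc_real hA).symm

lemma mpow_mean_eq_rpow_mean (hA : 0 ≤ A) (hB : 0 ≤ B) (p : ℝ) {α : ℝ}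
    (hα : α ∈ Set.Icc (0 : ℝ) 1) :
    mpow (α • mpow A p + (1 - α) • mpow B p) (1 / p) =
      (α • A ^ p + (1 - α) • B ^ p) ^ (1 / p) := by
  rw [mpow_eq_rpow hA, mpow_eq_rpow hB, mpow_eq_rpow]
  exact add_nonneg (smul_nonneg hα.1 CFC.rpow_nonneg)
    (smul_nonneg (sub_nonneg.2 hα.2) CFC.rpow_nonneg)

lemma loewnerLE_mpow_mean {p q : ℝ} (hp : 1 ≤ p) (hpq : p ≤ q) (hA : A.PosSemidef)
    (hB : B.PosSemidef) {α : ℝ} (hα : α ∈ Set.Icc (0 : ℝ) 1) :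
    loewnerLE (mpow (α • mpow A p + (1 - α) • mpow B p) (1 / p))
      (mpow (α • mpow A q + (1 - α) • mpow B q) (1 / q)) := by
  rw [mpow_mean_eq_rpow_mean hA.nonneg hB.nonneg p hα,
    mpow_mean_eq_rpow_mean hA.nonneg hB.nonneg q hα]
  exact CFC.rpow_mean_le_rpow_mean hp hpq hA.nonneg hB.nonneg hα

lemma spectrum_mpow_mean_subset {p : ℝ} (hp : 0 < p) (hA : A.PosSemidef) (hB : B.PosSemidef)
    {α : ℝ} (hα : α ∈ Set.Icc (0 : ℝ) 1) {K : Set ℝ} (hK : K.OrdConnected)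
    (hAK : spectrum ℝ A ⊆ K) (hBK : spectrum ℝ B ⊆ K) :
    spectrum ℝ (mpow (α • mpow A p + (1 - α) • mpow B p) (1 / p)) ⊆ K := by
  rcases isEmpty_or_nonempty (Fin n) with hn | hn
  · rw [spectrum.of_subsingleton]
    exact Set.empty_subset K
  · rw [mpow_mean_eq_rpow_mean hA.nonneg hB.nonneg p hα]
    exact CFC.spectrum_rpow_mean_subset hp hA.nonneg hB.nonneg hα hK hAK hBK

end Matrix

lemma loewnerLE.trans {n : ℕ} {X Y Z : Matrix (Fin n) (Fin n) ℂ} (hXY : loewnerLE X Y)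
    (hYZ : loewnerLE Y Z) : loewnerLE X Z := by
  simpa [loewnerLE] using Matrix.PosSemidef.add hYZ hXY

lemma isHermitian_mpow {n : ℕ} (A : Matrix (Fin n) (Fin n) ℂ) (p : ℝ) : (mpow A p).IsHermitian :=
  cfc_predicate (R := ℝ) (p := IsSelfAdjoint) _ A

/-- If `1 ≤ p₁ ≤ p₂`, `f` is operator `(p₂,h)`-convex on `K` and `f` is operator monotone
on `K`, then `f` is operator `(p₁,h)`-convex on `K`. -/
theorem stmt3 (p₁ p₂ : ℝ) (hp₁ : 1 ≤ p₁) (hp₁₂ : p₁ ≤ p₂)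
    (K : Set ℝ) (hK : K ⊆ Set.Ici 0) (hKI : K.OrdConnected)
    (J : Set ℝ) (hJ : Set.Ioo (0 : ℝ) 1 ⊆ J) (hJpos : J ⊆ Set.Ici 0)
    (h : ℝ → ℝ) (hh0 : ∀ x ∈ J, 0 ≤ h x) (hhne : ∃ x ∈ J, h x ≠ 0)
    (f : ℝ → ℝ) (hf : OperatorPHConvexOn p₂ K h f) (hmono : OperatorMonotoneOn K f) :
    OperatorPHConvexOn p₁ K h f := by
  refine ⟨hf.1, hf.2.1, fun n A B hA hB hAK hBK α hα => ?_⟩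
  have hα' : α ∈ Set.Icc (0 : ℝ) 1 := Set.Ioo_subset_Icc_self hα
  exact (hmono n _ _ (isHermitian_mpow _ _) (isHermitian_mpow _ _)
    (spectrum_mpow_mean_subset (by linarith) hA hB hα' hKI hAK hBK)
    (spectrum_mpow_mean_subset (by linarith) hA hB hα' hKI hAK hBK)
    (loewnerLE_mpow_mean hp₁ hp₁₂ hA hB hα')).trans
    (hf.2.2 n A B hA hB hAK hBK α hα)
end

section
/- Let p > 0, K ⊆ ℝ⁺ a p-convex interval with 0 ∈ K, and h a nonnegative non-zero super-multiplicative function on an interval J ⊆ ℝ⁺ containing (0,1). If f is operator (p,h)-convex on K and f(0) = 0, then f([α A^p + β B^p]^{1/p}) ≤ h(α) f(A) + h(β) f(B) for all positive semidefinite matrices A, B with spectra in K and all α, β > 0 with α + β ≤ 1. -/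
open Matrix
open scoped ComplexOrder

section Auxiliary

open scoped MatrixOrder

variable {n : ℕ} {A B D : Matrix (Fin n) (Fin n) ℂ} {p M : ℝ}

theorem continuousOn_spectrum_matrix (A : Matrix (Fin n) (Fin n) ℂ) (g : ℝ → ℝ) :
    ContinuousOn g (spectrum ℝ A) :=
  A.finite_real_spectrum.continuousOn g

theorem mpow_nonneg (hA : 0 ≤ A) (p : ℝ) : 0 ≤ mpow A p :=
  cfc_nonneg fun _ hx => Real.rpow_nonneg (spectrum_nonneg_of_nonneg hA hx) p

theorem mpow_zero_matrix (hp : p ≠ 0) : mpow (0 : Matrix (Fin n) (Fin n) ℂ) p = 0 := by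
  simp [mpow, cfc_apply_zero, Real.zero_rpow hp]

theorem mpow_mpow_one_div (hp : p ≠ 0) (hD : 0 ≤ D) : mpow (mpow D (1 / p)) p = D := by
  have hsa : IsSelfAdjoint D := .of_nonneg hD
  rw [mpow, mpow, ← cfc_comp' (fun x : ℝ => x ^ p) (fun x : ℝ => x ^ (1 / p)) D
    ((D.finite_real_spectrum.image _).continuousOn _) (continuousOn_spectrum_matrix D _) hsa]
  conv_rhs => rw [← cfc_id ℝ D hsa]
  refine cfc_congr fun x hx => ?_
  simp only [id]
  rw [← Real.rpow_mul (spectrum_nonneg_of_nonneg hD hx), one_div_mul_cancel hp, Real.rpow_one]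

theorem mpow_le_algebraMap (hp : 0 ≤ p) (hA : 0 ≤ A) (hM : ∀ x ∈ spectrum ℝ A, x ≤ M) :
    mpow A p ≤ algebraMap ℝ _ (M ^ p) :=
  cfc_le_algebraMap _ _ _
    (fun x hx => Real.rpow_le_rpow (spectrum_nonneg_of_nonneg hA hx) (hM x hx) hp)
    (continuousOn_spectrum_matrix A _) (.of_nonneg hA)

/-- The spectrum of a weighted `p`-mean of two positive semidefinite matrices bounded by `M`
lies in `[0, M]`. -/
theorem spectrum_mpow_convexCombination_subset (hp : 0 < p) (hA : 0 ≤ A) (hB : 0 ≤ B)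
    (hM : 0 ≤ M) (hAM : ∀ x ∈ spectrum ℝ A, x ≤ M) (hBM : ∀ x ∈ spectrum ℝ B, x ≤ M)
    {a b : ℝ} (ha : 0 ≤ a) (hb : 0 ≤ b) (hab : a + b = 1) :
    spectrum ℝ (mpow (a • mpow A p + b • mpow B p) (1 / p)) ⊆ Set.Icc 0 M := by
  set D := a • mpow A p + b • mpow B p with hDdef
  have hD : 0 ≤ D :=
    add_nonneg (smul_nonneg ha (mpow_nonneg hA p)) (smul_nonneg hb (mpow_nonneg hB p))
  have hsa : IsSelfAdjoint D := .of_nonneg hD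
  have hDM : D ≤ algebraMap ℝ _ (M ^ p) :=
    calc D ≤ a • algebraMap ℝ _ (M ^ p) + b • algebraMap ℝ _ (M ^ p) :=
          add_le_add (smul_le_smul_of_nonneg_left (mpow_le_algebraMap hp.le hA hAM) ha)
            (smul_le_smul_of_nonneg_left (mpow_le_algebraMap hp.le hB hBM) hb)
      _ = algebraMap ℝ _ (M ^ p) := by rw [← add_smul, hab, one_smul]
  rw [mpow, cfc_map_spectrum (fun x : ℝ => x ^ (1 / p)) D hsa (continuousOn_spectrum_matrix D _)]
  rintro _ ⟨x, hx, rfl⟩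
  have hx0 : 0 ≤ x := spectrum_nonneg_of_nonneg hD hx
  have hxM : x ≤ M ^ p := (le_algebraMap_iff_spectrum_le hsa).1 hDM x hx
  refine ⟨Real.rpow_nonneg hx0 _, ?_⟩
  calc x ^ (1 / p) ≤ (M ^ p) ^ (1 / p) := Real.rpow_le_rpow hx0 hxM (by positivity)
    _ = M := by rw [← Real.rpow_mul hM, mul_one_div_cancel hp.ne', Real.rpow_one]

end Auxiliary

/-- If `0 ∈ K`, `h` is super-multiplicative, `f` is operator `(p,h)`-convex on `K` and
`f(0) = 0`, then `f([α A^p + β B^p]^{1/p}) ≤ h(α) f(A) + h(β) f(B)` for all positive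
semidefinite `A, B` with spectra in `K` and all `α, β > 0` with `α + β ≤ 1`. -/
theorem stmt4 (p : ℝ) (hp : 0 < p) (K : Set ℝ) (hK : K ⊆ Set.Ici 0) (hKI : K.OrdConnected)
    (hKp : PConvex p K) (h0K : (0 : ℝ) ∈ K)
    (J : Set ℝ) (hJ : Set.Ioo (0 : ℝ) 1 ⊆ J) (hJpos : J ⊆ Set.Ici 0)
    (h : ℝ → ℝ) (hh0 : ∀ x ∈ J, 0 ≤ h x) (hhne : ∃ x ∈ J, h x ≠ 0)
    (hsm : SuperMultiplicativeOn J h)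
    (f : ℝ → ℝ) (hf : OperatorPHConvexOn p K h f) (hf0 : f 0 = 0) :
    ∀ (n : ℕ) (A B : Matrix (Fin n) (Fin n) ℂ), A.PosSemidef → B.PosSemidef →
      spectrum ℝ A ⊆ K → spectrum ℝ B ⊆ K →
      ∀ α β : ℝ, 0 < α → 0 < β → α + β ≤ 1 →
        loewnerLE (cfc f (mpow (α • mpow A p + β • mpow B p) (1 / p)))
          (h α • cfc f A + h β • cfc f B) := by
  open scoped MatrixOrder in
  intro n A B hA hB hAK hBK α β hα hβ hαβ
  obtain ⟨hfpos, -, hconv⟩ := hf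
  obtain hsum | hlt := hαβ.eq_or_lt
  · obtain rfl : β = 1 - α := by linarith
    exact hconv n A B hA hB hAK hBK α ⟨hα, by linarith⟩
  have hA0 : 0 ≤ A := hA.nonneg
  have hB0 : 0 ≤ B := hB.nonneg
  set γ := α + β with hγ
  have hγ0 : 0 < γ := by positivity
  have hαγ : α / γ ∈ Set.Ioo (0 : ℝ) 1 := ⟨by positivity, (div_lt_one hγ0).2 (by linarith)⟩
  have hβγ : β / γ ∈ Set.Ioo (0 : ℝ) 1 := ⟨by positivity, (div_lt_one hγ0).2 (by linarith)⟩
  have hγI : γ ∈ Set.Ioo (0 : ℝ) 1 := ⟨hγ0, hlt⟩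
  have hadd : α / γ + β / γ = 1 := by rw [← add_div, ← hγ, div_self hγ0.ne']
  obtain ⟨M, hMK, hM0, hAM, hBM⟩ : ∃ M ∈ K, 0 ≤ M ∧ (∀ x ∈ spectrum ℝ A, x ≤ M) ∧
      ∀ x ∈ spectrum ℝ B, x ≤ M := by
    obtain ⟨M, hM, hmax⟩ := Set.exists_max_image (insert 0 (spectrum ℝ A ∪ spectrum ℝ B)) id
      ((A.finite_real_spectrum.union B.finite_real_spectrum).insert 0) ⟨0, Set.mem_insert _ _⟩
    refine ⟨M, Set.insert_subset h0K (Set.union_subset hAK hBK) hM, hmax 0 (Set.mem_insert _ _),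
      fun x hx => hmax x (.inr (.inl hx)), fun x hx => hmax x (.inr (.inr hx))⟩
  set D := (α / γ) • mpow A p + (β / γ) • mpow B p with hD
  have hD0 : 0 ≤ D := add_nonneg (smul_nonneg hαγ.1.le (mpow_nonneg hA0 p))
    (smul_nonneg hβγ.1.le (mpow_nonneg hB0 p))
  set C := mpow D (1 / p) with hC
  have hCK : spectrum ℝ C ⊆ K :=
    (spectrum_mpow_convexCombination_subset hp hA0 hB0 hM0 hAM hBM hαγ.1.le hβγ.1.le hadd).trans
      (hKI.out h0K hMK)
  have houter : cfc f (mpow (α • mpow A p + β • mpow B p) (1 / p)) ≤ h γ • cfc f C := by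
    have hzero : spectrum ℝ (0 : Matrix (Fin n) (Fin n) ℂ) ⊆ K := by
      have := CFC.spectrum_algebraMap_subset (A := Matrix (Fin n) (Fin n) ℂ) (0 : ℝ)
      rw [map_zero] at this
      exact this.trans (Set.singleton_subset_iff.2 h0K)
    have key := hconv n C 0 (mpow_nonneg hD0 _).posSemidef PosSemidef.zero hCK hzero γ hγI
    have harg : γ • D = α • mpow A p + β • mpow B p := by
      rw [hD, smul_add, smul_smul, smul_smul, mul_div_cancel₀ _ hγ0.ne',
        mul_div_cancel₀ _ hγ0.ne']
    rwa [hC, mpow_mpow_one_div hp.ne' hD0, mpow_zero_matrix hp.ne', smul_zero, add_zero, harg,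
      cfc_apply_zero, hf0, map_zero, smul_zero, add_zero] at key
  have hinner : cfc f C ≤ h (α / γ) • cfc f A + h (β / γ) • cfc f B := by
    have key := hconv n A B hA hB hAK hBK (α / γ) hαγ
    rwa [show 1 - α / γ = β / γ by linarith] at key
  have hhmul : ∀ t : ℝ, t / γ ∈ Set.Ioo (0 : ℝ) 1 → h γ * h (t / γ) ≤ h t := fun t ht => by
    simpa [mul_div_cancel₀ t hγ0.ne'] using hsm γ (hJ hγI) (t / γ) (hJ ht)
  have hfA : 0 ≤ cfc f A := cfc_nonneg fun x hx => hfpos x (hAK hx)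
  have hfB : 0 ≤ cfc f B := cfc_nonneg fun x hx => hfpos x (hBK hx)
  change cfc f (mpow (α • mpow A p + β • mpow B p) (1 / p)) ≤ h α • cfc f A + h β • cfc f B
  calc cfc f (mpow (α • mpow A p + β • mpow B p) (1 / p)) ≤ h γ • cfc f C := houter
    _ ≤ h γ • (h (α / γ) • cfc f A + h (β / γ) • cfc f B) :=
        smul_le_smul_of_nonneg_left hinner (hh0 γ (hJ hγI))
    _ = (h γ * h (α / γ)) • cfc f A + (h γ * h (β / γ)) • cfc f B := by
        rw [smul_add, smul_smul, smul_smul]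
    _ ≤ h α • cfc f A + h β • cfc f B :=
        add_le_add (smul_le_smul_of_nonneg_right (hhmul α hαγ) hfA)
          (smul_le_smul_of_nonneg_right (hhmul β hβγ) hfB)
end

section
/- (Jensen type inequality) Let p > 0, K ⊆ ℝ⁺ a p-convex set, and h a nonnegative super-multiplicative function on an interval J ⊆ ℝ⁺ containing (0,1). If f is operator (p,h)-convex on K, then for any k positive semidefinite matrices A₁, …, A_k with spectra in K and any α₁, …, α_k ∈ (0,1) with Σᵢ αᵢ = 1, f([Σᵢ αᵢ Aᵢ^p]^{1/p}) ≤ Σᵢ h(αᵢ) f(Aᵢ). -/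
open Matrix
open scoped ComplexOrder

open scoped MatrixOrder in
/-- A convex combination of Hermitian matrices with spectra in a convex set of reals
has its spectrum in that set. -/
theorem spectrum_sum_smul_subset_of_convex {n : ℕ} {ι : Type*} [Fintype ι] {I : Set ℝ}
    (hI : Convex ℝ I) (A : ι → Matrix (Fin n) (Fin n) ℂ) (α : ι → ℝ)
    (hA : ∀ i, (A i).IsHermitian) (hsA : ∀ i, spectrum ℝ (A i) ⊆ I)
    (hα : ∀ i, 0 ≤ α i) (hsum : ∑ i, α i = 1) :
    spectrum ℝ (∑ i, α i • A i) ⊆ I := by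
  have hS : IsSelfAdjoint (∑ i, α i • A i) :=
    isSelfAdjoint_sum _ fun i _ => (IsSelfAdjoint.all (α i)).smul (hA i)
  intro x hx
  have hx' := hx
  rw [Matrix.IsHermitian.spectrum_real_eq_range_eigenvalues hS] at hx'
  obtain ⟨j, -⟩ := hx'
  have : Nonempty (Fin n) := ⟨j⟩
  have : Nonempty ι := by
    by_contra hne
    rw [not_nonempty_iff] at hne
    simp at hsum
  have hmem : ∀ q : ι × Fin n, (hA q.1).eigenvalues q.2 ∈ spectrum ℝ (A q.1) := fun q => by
    rw [(hA q.1).spectrum_real_eq_range_eigenvalues]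
    exact ⟨_, rfl⟩
  obtain ⟨q, hq⟩ := Finite.exists_min fun q : ι × Fin n => (hA q.1).eigenvalues q.2
  obtain ⟨r, hr⟩ := Finite.exists_max fun q : ι × Fin n => (hA q.1).eigenvalues q.2
  have hone : ∀ c : ℝ, ∑ i, α i • algebraMap ℝ (Matrix (Fin n) (Fin n) ℂ) c =
      algebraMap ℝ _ c := fun c => by
    rw [← Finset.sum_smul, hsum, one_smul]
  have hle : algebraMap ℝ _ ((hA q.1).eigenvalues q.2) ≤ ∑ i, α i • A i := by
    rw [← hone]
    refine Finset.sum_le_sum fun i _ => smul_le_smul_of_nonneg_left ?_ (hα i)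
    rw [algebraMap_le_iff_le_spectrum (ha := hA i)]
    intro y hy
    rw [(hA i).spectrum_real_eq_range_eigenvalues] at hy
    obtain ⟨l, rfl⟩ := hy
    exact hq (i, l)
  have hge : ∑ i, α i • A i ≤ algebraMap ℝ _ ((hA r.1).eigenvalues r.2) := by
    rw [← hone]
    refine Finset.sum_le_sum fun i _ => smul_le_smul_of_nonneg_left ?_ (hα i)
    rw [le_algebraMap_iff_spectrum_le (ha := hA i)]
    intro y hy
    rw [(hA i).spectrum_real_eq_range_eigenvalues] at hy
    obtain ⟨l, rfl⟩ := hy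
    exact hr (i, l)
  rw [algebraMap_le_iff_le_spectrum (ha := hS)] at hle
  rw [le_algebraMap_iff_spectrum_le (ha := hS)] at hge
  exact hI.ordConnected.out (hsA _ (hmem q)) (hsA _ (hmem r)) ⟨hle x hx, hge x hx⟩

/-- A matrix function that is nonnegative on the spectrum is positive semidefinite. -/
theorem posSemidef_cfc {n : ℕ} {f : ℝ → ℝ} {A : Matrix (Fin n) (Fin n) ℂ}
    (hf : ∀ x ∈ spectrum ℝ A, 0 ≤ f x) : (cfc f A).PosSemidef := by
  open scoped MatrixOrder in
  exact Matrix.nonneg_iff_posSemidef.mp (cfc_nonneg hf)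

theorem spectrum_nonneg_of_posSemidef {n : ℕ} {A : Matrix (Fin n) (Fin n) ℂ}
    (hA : A.PosSemidef) : ∀ x ∈ spectrum ℝ A, 0 ≤ x := by
  intro x hx
  rw [hA.1.spectrum_real_eq_range_eigenvalues] at hx
  obtain ⟨i, rfl⟩ := hx
  exact hA.eigenvalues_nonneg i

theorem posSemidef_mpow {n : ℕ} {A : Matrix (Fin n) (Fin n) ℂ} (hA : A.PosSemidef) (p : ℝ) :
    (mpow A p).PosSemidef :=
  posSemidef_cfc fun x hx => Real.rpow_nonneg (spectrum_nonneg_of_posSemidef hA x hx) p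

theorem spectrum_mpow {n : ℕ} {A : Matrix (Fin n) (Fin n) ℂ} (hA : A.PosSemidef) {p : ℝ}
    (hp : 0 ≤ p) : spectrum ℝ (mpow A p) = (fun x : ℝ => x ^ p) '' spectrum ℝ A :=
  cfc_map_spectrum (R := ℝ) (fun x : ℝ => x ^ p) A (ha := hA.1)
    (hf := (Real.continuous_rpow_const hp).continuousOn)

theorem mpow_one_div_mpow {n : ℕ} {A : Matrix (Fin n) (Fin n) ℂ} (hA : A.PosSemidef) {p : ℝ}
    (hp : 0 < p) : mpow (mpow A (1 / p)) p = A := by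
  have hp' : (0 : ℝ) ≤ 1 / p := by positivity
  have hA' : IsSelfAdjoint A := hA.1
  unfold mpow
  rw [← cfc_comp' (fun x : ℝ => x ^ p) (fun x : ℝ => x ^ (1 / p)) A
    (hg := (Real.continuous_rpow_const hp.le).continuousOn)
    (hf := (Real.continuous_rpow_const hp').continuousOn)]
  conv_rhs => rw [← cfc_id' ℝ A]
  refine cfc_congr fun x hx => ?_
  have h0 := spectrum_nonneg_of_posSemidef hA x hx
  rw [← Real.rpow_mul h0, one_div_mul_cancel hp.ne', Real.rpow_one]

theorem PConvex.convex_image_rpow {p : ℝ} (hp : 0 < p) {K : Set ℝ} (hK : K ⊆ Set.Ici 0)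
    (hKp : PConvex p K) : Convex ℝ ((fun x : ℝ => x ^ p) '' K) := by
  rintro _ ⟨x, hx, rfl⟩ _ ⟨y, hy, rfl⟩ a b ha hb hab
  obtain rfl : b = 1 - a := by linarith
  refine ⟨_, hKp x hx y hy a ⟨ha, by linarith⟩, ?_⟩
  have h0 : 0 ≤ a * x ^ p + (1 - a) * y ^ p :=
    add_nonneg (mul_nonneg ha (Real.rpow_nonneg (hK hx) p))
      (mul_nonneg hb (Real.rpow_nonneg (hK hy) p))
  simp only [smul_eq_mul]
  rw [← Real.rpow_mul h0, one_div_mul_cancel hp.ne', Real.rpow_one]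

/-- The spectrum of a weighted `p`-power mean of matrices with spectra in a `p`-convex set `K`
lies in `K`. -/
theorem spectrum_mpow_sum_subset {p : ℝ} (hp : 0 < p) {K : Set ℝ} (hK : K ⊆ Set.Ici 0)
    (hKp : PConvex p K) {n : ℕ} {ι : Type*} [Fintype ι] (A : ι → Matrix (Fin n) (Fin n) ℂ)
    (α : ι → ℝ) (hA : ∀ i, (A i).PosSemidef) (hsA : ∀ i, spectrum ℝ (A i) ⊆ K)
    (hα : ∀ i, 0 ≤ α i) (hsum : ∑ i, α i = 1) :
    spectrum ℝ (mpow (∑ i, α i • mpow (A i) p) (1 / p)) ⊆ K := by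
  have hS : (∑ i, α i • mpow (A i) p).PosSemidef :=
    Matrix.posSemidef_sum _ fun i _ => (posSemidef_mpow (hA i) p).smul (hα i)
  have hsub := spectrum_sum_smul_subset_of_convex (hKp.convex_image_rpow hp hK)
    (fun i => mpow (A i) p) α (fun i => (posSemidef_mpow (hA i) p).1)
    (fun i => by
      rw [spectrum_mpow (hA i) hp.le]
      exact Set.image_mono (hsA i)) hα hsum
  rw [spectrum_mpow hS (by positivity)]
  rintro _ ⟨y, hy, rfl⟩
  obtain ⟨x, hx, rfl⟩ := hsub hy
  simp only
  rwa [← Real.rpow_mul (hK hx), mul_one_div_cancel hp.ne', Real.rpow_one]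

/-- Jensen type inequality: if `h` is a nonnegative super-multiplicative function and `f`
is operator `(p,h)`-convex on `K`, then for any positive semidefinite matrices
`A₁, …, A_k` with spectra in `K` and any `α₁, …, α_k ∈ (0,1)` with `∑ αᵢ = 1`,
`f([∑ αᵢ Aᵢ^p]^{1/p}) ≤ ∑ h(αᵢ) f(Aᵢ)`. -/
theorem stmt7 (p : ℝ) (hp : 0 < p) (K : Set ℝ) (hK : K ⊆ Set.Ici 0) (hKp : PConvex p K)
    (J : Set ℝ) (hJ : Set.Ioo (0 : ℝ) 1 ⊆ J) (hJpos : J ⊆ Set.Ici 0)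
    (h : ℝ → ℝ) (hh0 : ∀ x ∈ J, 0 ≤ h x) (hsm : SuperMultiplicativeOn J h)
    (f : ℝ → ℝ) (hf : OperatorPHConvexOn p K h f)
    (k n : ℕ) (A : Fin k → Matrix (Fin n) (Fin n) ℂ) (α : Fin k → ℝ)
    (hA : ∀ i, (A i).PosSemidef) (hsA : ∀ i, spectrum ℝ (A i) ⊆ K)
    (hα : ∀ i, α i ∈ Set.Ioo (0 : ℝ) 1) (hsum : ∑ i, α i = 1) :
    loewnerLE (cfc f (mpow (∑ i, α i • mpow (A i) p) (1 / p)))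
      (∑ i, h (α i) • cfc f (A i)) := by
  induction k with
  | zero => simp at hsum
  | succ k ih =>
    set a := α 0 with ha
    have ha' : a ∈ Set.Ioo (0 : ℝ) 1 := hα 0
    have h1a : 1 - a ∈ Set.Ioo (0 : ℝ) 1 := ⟨by linarith [ha'.2], by linarith [ha'.1]⟩
    have hne : 1 - a ≠ 0 := h1a.1.ne'
    rw [Fin.sum_univ_succ, Fin.sum_univ_succ]
    have htail : ∑ i : Fin k, α i.succ = 1 - a := by
      rw [Fin.sum_univ_succ] at hsum
      linarith
    rcases k with _ | _ | k
    · simp at htail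
      exact absurd htail.symm hne
    · have hα1 : α 1 = 1 - a := by simpa using htail
      simpa [hα1, ha] using
        hf.2.2 n (A 0) (A 1) (hA 0) (hA 1) (hsA 0) (hsA 1) a ha'
    · set β : Fin (k + 2) → ℝ := fun i => α i.succ / (1 - a) with hβ
      have hβ_sum : ∑ i, β i = 1 := by
        rw [← Finset.sum_div, htail, div_self hne]
      have hβ_pos : ∀ i, 0 < β i := fun i => div_pos (hα i.succ).1 h1a.1
      have hβ_mem : ∀ i, β i ∈ Set.Ioo (0 : ℝ) 1 := by
        refine fun i => ⟨hβ_pos i, ?_⟩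
        obtain ⟨j, hj⟩ := exists_ne i
        rw [← hβ_sum]
        exact Finset.single_lt_sum hj (Finset.mem_univ i) (Finset.mem_univ j) (hβ_pos j)
          fun l _ _ => (hβ_pos l).le
      have hαβ : ∀ i : Fin (k + 2), α i.succ = (1 - a) * β i := fun i => by
        rw [hβ]
        field_simp
      set S := ∑ i : Fin (k + 2), β i • mpow (A i.succ) p with hS
      have hSpos : S.PosSemidef := Matrix.posSemidef_sum _ fun i _ =>
        (posSemidef_mpow (hA i.succ) p).smul (hβ_pos i).le
      have hS_eq : ∑ i : Fin (k + 2), α i.succ • mpow (A i.succ) p = (1 - a) • S := by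
        rw [hS, Finset.smul_sum]
        exact Finset.sum_congr rfl fun i _ => by rw [hαβ, mul_smul]
      have hstep := hf.2.2 n (A 0) (mpow S (1 / p)) (hA 0) (posSemidef_mpow hSpos _) (hsA 0)
        (spectrum_mpow_sum_subset hp hK hKp (fun i => A (Fin.succ i)) β (fun i => hA i.succ)
          (fun i => hsA i.succ) (fun i => (hβ_pos i).le) hβ_sum) a ha'
      rw [mpow_one_div_mpow hSpos hp] at hstep
      have hih := ih (fun i => A i.succ) β (fun i => hA i.succ) (fun i => hsA i.succ) hβ_mem hβ_sum
      have hsuper : (∑ i : Fin (k + 2),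
          (h (α i.succ) - h (1 - a) * h (β i)) • cfc f (A i.succ)).PosSemidef := by
        refine Matrix.posSemidef_sum _ fun i _ =>
          (posSemidef_cfc fun x hx => hf.1 x (hsA i.succ hx)).smul ?_
        rw [hαβ]
        exact sub_nonneg.mpr (hsm _ (hJ h1a) _ (hJ (hβ_mem i)))
      rw [hS_eq]
      unfold loewnerLE at hstep hih ⊢
      convert (hstep.add (hih.smul (hh0 _ (hJ h1a)))).add hsuper using 1
      simp only [sub_smul, mul_smul, Finset.sum_sub_distrib, smul_sub, Finset.smul_sum]
      abel
end

section
/- (Hansen–Pedersen type inequality) Let p > 0, K ⊆ ℝ⁺ a p-convex set, h a super-multiplicative function on an interval J ⊆ ℝ⁺ containing (0,1), and f an operator (p,h)-convex function on K. Then for any positive semidefinite n×n matrices A, B with spectra in K and any n×n matrices C, D with C C* + D D* = Iₙ, f([C A^p C* + D B^p D*]^{1/p}) ≤ 2 h(1/2) (C f(A) C* + D f(B) D*). -/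
open Matrix
open scoped ComplexOrder

/-- The functional calculus of Hermitian matrices commutes with star homomorphisms defined on a
product of two matrix algebras. -/
lemma cfc_starAlgHom_prod {n m : Type*} [Fintype n] [DecidableEq n] [Fintype m] [DecidableEq m]
    (ψ : (Matrix n n ℂ × Matrix n n ℂ) →⋆ₐ[ℝ] Matrix m m ℂ) (f : ℝ → ℝ)
    {A B : Matrix n n ℂ} (hA : A.IsHermitian) (hB : B.IsHermitian) :
    cfc f (ψ (A, B)) = ψ (cfc f A, cfc f B) := by
  have hψ : IsSelfAdjoint (ψ (A, B)) := by
    have : IsSelfAdjoint (A, B) := Prod.ext hA hB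
    exact this.map ψ
  let s : Finset ℝ := (A.finite_real_spectrum.union B.finite_real_spectrum).toFinset
  let q : Polynomial ℝ := Lagrange.interpolate s id f
  have hq : Set.EqOn f q.eval (spectrum ℝ A ∪ spectrum ℝ B) := fun x hx =>
    (Lagrange.eval_interpolate_at_node (s := s) (v := id) f (Set.injOn_id _)
      (by simpa [s] using hx)).symm
  have hsub : spectrum ℝ (ψ (A, B)) ⊆ spectrum ℝ A ∪ spectrum ℝ B := by
    rw [← Prod.spectrum_eq]
    exact AlgHom.spectrum_apply_subset ψ (A, B)
  rw [cfc_congr (hq.mono hsub), cfc_congr (hq.mono Set.subset_union_left),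
    cfc_congr (hq.mono Set.subset_union_right), cfc_polynomial q _ hψ,
    cfc_polynomial q A hA.isSelfAdjoint,
    cfc_polynomial q B hB.isSelfAdjoint]
  exact (Polynomial.aeval_algHom_apply ψ.toAlgHom (A, B) q).trans
    (congrArg ψ (Polynomial.aeval_prod_apply (A, B) q))

/-- The star homomorphism `(A, B) ↦ U * diag(A, B) * Uᴴ` attached to a unitary `U`, with the
two index blocks merged into one. -/
noncomputable def blockConj {n : ℕ} (U : Matrix (Fin n ⊕ Fin n) (Fin n ⊕ Fin n) ℂ)
    (hU : U * Uᴴ = 1) :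
    (Matrix (Fin n) (Fin n) ℂ × Matrix (Fin n) (Fin n) ℂ) →⋆ₐ[ℝ]
      Matrix (Fin (n + n)) (Fin (n + n)) ℂ where
  toFun X := (U * fromBlocks X.1 0 0 X.2 * Uᴴ).submatrix finSumFinEquiv.symm finSumFinEquiv.symm
  map_one' := by simp [fromBlocks_one, hU]
  map_mul' X Y := by
    have h : fromBlocks (X * Y).1 0 0 (X * Y).2 =
        fromBlocks X.1 0 0 X.2 * (Uᴴ * U) * fromBlocks Y.1 0 0 Y.2 := by
      rw [mul_eq_one_comm.mp hU]
      simp [fromBlocks_multiply]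
    rw [h, submatrix_mul_equiv]
    simp only [Matrix.mul_assoc]
  map_zero' := by simp
  map_add' X Y := by
    have h : fromBlocks (X + Y).1 0 0 (X + Y).2 =
        fromBlocks X.1 0 0 X.2 + fromBlocks Y.1 0 0 Y.2 := by
      simp [fromBlocks_add]
    rw [h, Matrix.mul_add, Matrix.add_mul]
    rfl
  commutes' r := by
    have h : fromBlocks (algebraMap ℝ (Matrix (Fin n) (Fin n) ℂ × Matrix (Fin n) (Fin n) ℂ) r).1 0 0
        (algebraMap ℝ (Matrix (Fin n) (Fin n) ℂ × Matrix (Fin n) (Fin n) ℂ) r).2 =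
        r • (1 : Matrix (Fin n ⊕ Fin n) (Fin n ⊕ Fin n) ℂ) := by
      rw [Algebra.algebraMap_eq_smul_one, ← fromBlocks_one, fromBlocks_smul]
      simp
    rw [h, Matrix.mul_smul, Matrix.smul_mul, Matrix.mul_one, hU, submatrix_smul,
      Algebra.algebraMap_eq_smul_one]
    simp
  map_star' X := by
    simp [star_eq_conjTranspose, conjTranspose_mul, fromBlocks_conjTranspose, Matrix.mul_assoc]

lemma blockConj_apply {n : ℕ} (U : Matrix (Fin n ⊕ Fin n) (Fin n ⊕ Fin n) ℂ) (hU : U * Uᴴ = 1)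
    (X Y : Matrix (Fin n) (Fin n) ℂ) :
    blockConj U hU (X, Y) = (U * fromBlocks X 0 0 Y * Uᴴ).submatrix
      finSumFinEquiv.symm finSumFinEquiv.symm := rfl

/-- A pair `C, D` with `C * Cᴴ + D * Dᴴ = 1` is the first block row of a unitary matrix. -/
lemma exists_unitary_fromBlocks {n : Type*} [Fintype n] [DecidableEq n] (C D : Matrix n n ℂ)
    (hCD : C * Cᴴ + D * Dᴴ = 1) :
    ∃ X Y : Matrix n n ℂ, fromBlocks C D X Y * (fromBlocks C D X Y)ᴴ = 1 := by
  let v : n ⊕ n → EuclideanSpace ℂ (n ⊕ n) :=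
    fun i => WithLp.toLp 2 (fromBlocks C D 0 0 i)
  have hv : Orthonormal ℂ ((Set.range Sum.inl).domRestrict v) := by
    rw [orthonormal_iff_ite]
    rintro ⟨_, i, rfl⟩ ⟨_, j, rfl⟩
    have := congrFun (congrFun hCD j) i
    simp only [Matrix.add_apply, Matrix.mul_apply, conjTranspose_apply, Matrix.one_apply] at this
    simpa [v, PiLp.inner_apply, Subtype.ext_iff, eq_comm] using this
  obtain ⟨b, hb⟩ := hv.exists_orthonormalBasis_extension_of_card_eq (by simp)
  refine ⟨of fun i j => b (Sum.inr i) (Sum.inl j), of fun i j => b (Sum.inr i) (Sum.inr j), ?_⟩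
  have hrow : fromBlocks C D (of fun i j => b (Sum.inr i) (Sum.inl j))
      (of fun i j => b (Sum.inr i) (Sum.inr j)) = of fun i j => b i j := by
    ext i j
    rcases i with i | i
    · rw [of_apply, hb _ ⟨i, rfl⟩]
      rcases j with j | j <;> rfl
    · rcases j with j | j <;> rfl
  rw [hrow]
  ext i j
  have := orthonormal_iff_ite.mp b.orthonormal j i
  simpa [Matrix.mul_apply, Matrix.one_apply, PiLp.inner_apply, eq_comm] using this

/-- Averaging a block conjugation with its image under the symmetry `diag(1, -1)` keeps only the
diagonal blocks. -/
lemma blockConj_add_blockConj {n : ℕ} (C D X Y : Matrix (Fin n) (Fin n) ℂ)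
    (hU : fromBlocks C D X Y * (fromBlocks C D X Y)ᴴ = 1)
    (hV : fromBlocks C D (-X) (-Y) * (fromBlocks C D (-X) (-Y))ᴴ = 1)
    (P Q : Matrix (Fin n) (Fin n) ℂ) :
    blockConj _ hU (P, Q) + blockConj _ hV (P, Q) =
      (2 : ℝ) • blockConj 1 (by simp)
        (C * P * Cᴴ + D * Q * Dᴴ, X * P * Xᴴ + Y * Q * Yᴴ) := by
  have h : fromBlocks C D X Y * fromBlocks P 0 0 Q * (fromBlocks C D X Y)ᴴ +
      fromBlocks C D (-X) (-Y) * fromBlocks P 0 0 Q * (fromBlocks C D (-X) (-Y))ᴴ =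
      (2 : ℝ) • fromBlocks (C * P * Cᴴ + D * Q * Dᴴ) 0 0 (X * P * Xᴴ + Y * Q * Yᴴ) := by
    simp only [fromBlocks_conjTranspose, fromBlocks_multiply, fromBlocks_add, fromBlocks_smul]
    congr 1 <;> simp [two_smul] <;> abel
  simp only [blockConj_apply, conjTranspose_one, Matrix.one_mul, Matrix.mul_one]
  ext i j
  exact congrFun (congrFun h _) _

/-- Hansen–Pedersen type inequality: if `f` is operator `(p,h)`-convex on `K`, then for
positive semidefinite `A, B` with spectra in `K` and matrices `C, D` with
`C C* + D D* = I`, `f([C A^p C* + D B^p D*]^{1/p}) ≤ 2 h(1/2) (C f(A) C* + D f(B) D*)`. -/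
theorem stmt11 (p : ℝ) (hp : 0 < p) (K : Set ℝ) (hK : K ⊆ Set.Ici 0) (hKp : PConvex p K)
    (J : Set ℝ) (hJ : Set.Ioo (0 : ℝ) 1 ⊆ J) (hJpos : J ⊆ Set.Ici 0)
    (h : ℝ → ℝ) (hh0 : ∀ x ∈ J, 0 ≤ h x) (hsm : SuperMultiplicativeOn J h)
    (f : ℝ → ℝ) (hf : OperatorPHConvexOn p K h f)
    (n : ℕ) (A B C D : Matrix (Fin n) (Fin n) ℂ)
    (hA : A.PosSemidef) (hB : B.PosSemidef)
    (hsA : spectrum ℝ A ⊆ K) (hsB : spectrum ℝ B ⊆ K)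
    (hCD : C * Cᴴ + D * Dᴴ = 1) :
    loewnerLE (cfc f (mpow (C * mpow A p * Cᴴ + D * mpow B p * Dᴴ) (1 / p)))
      ((2 * h (1 / 2)) • (C * cfc f A * Cᴴ + D * cfc f B * Dᴴ)) := by
  obtain ⟨X, Y, hU⟩ := exists_unitary_fromBlocks C D hCD
  have hV : fromBlocks C D (-X) (-Y) * (fromBlocks C D (-X) (-Y))ᴴ = 1 := by
    rw [fromBlocks_conjTranspose, fromBlocks_multiply, ← fromBlocks_one, fromBlocks_inj] at hU ⊢
    obtain ⟨h1, h2, h3, h4⟩ := hU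
    refine ⟨h1, ?_, ?_, ?_⟩
    · simpa [← neg_add_rev, add_comm] using h2
    · simpa [← neg_add_rev, add_comm] using h3
    · simpa using h4
  have hspec : ∀ ψ : (Matrix (Fin n) (Fin n) ℂ × Matrix (Fin n) (Fin n) ℂ) →⋆ₐ[ℝ]
      Matrix (Fin (n + n)) (Fin (n + n)) ℂ, spectrum ℝ (ψ (A, B)) ⊆ K := fun ψ =>
    (AlgHom.spectrum_apply_subset ψ (A, B)).trans
      (by rw [Prod.spectrum_eq]; exact Set.union_subset hsA hsB)
  have hpsd : ∀ ψ : (Matrix (Fin n) (Fin n) ℂ × Matrix (Fin n) (Fin n) ℂ) →⋆ₐ[ℝ]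
      Matrix (Fin (n + n)) (Fin (n + n)) ℂ, (ψ (A, B)).PosSemidef := fun ψ => by
    have hsa : IsSelfAdjoint (A, B) := Prod.ext hA.1 hB.1
    have hψ : (ψ (A, B)).IsHermitian := hsa.map ψ
    exact hψ.posSemidef_iff_eigenvalues_nonneg.mpr
      fun i => hK (hspec ψ (hψ.eigenvalues_mem_spectrum_real i))
  have hpow : ∀ ψ : (Matrix (Fin n) (Fin n) ℂ × Matrix (Fin n) (Fin n) ℂ) →⋆ₐ[ℝ]
      Matrix (Fin (n + n)) (Fin (n + n)) ℂ, mpow (ψ (A, B)) p = ψ (mpow A p, mpow B p) :=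
    fun ψ => cfc_starAlgHom_prod ψ _ hA.1 hB.1
  have hherm : ∀ Z W : Matrix (Fin n) (Fin n) ℂ,
      (Z * mpow A p * Zᴴ + W * mpow B p * Wᴴ).IsHermitian := fun Z W =>
    (isHermitian_mul_mul_conjTranspose Z (isHermitian_mpow A p)).add
      (isHermitian_mul_mul_conjTranspose W (isHermitian_mpow B p))
  have key := hf.2.2 (n + n) _ _ (hpsd (blockConj _ hU)) (hpsd (blockConj _ hV))
    (hspec _) (hspec _) (1 / 2) ⟨by norm_num, by norm_num⟩
  rw [show (1 : ℝ) - 1 / 2 = 1 / 2 by norm_num, ← smul_add, ← smul_add, hpow, hpow,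
    cfc_starAlgHom_prod _ f hA.1 hB.1, cfc_starAlgHom_prod _ f hA.1 hB.1,
    blockConj_add_blockConj, blockConj_add_blockConj, smul_smul, smul_smul,
    show (1 / 2 : ℝ) * 2 = 1 by norm_num, one_smul, mul_comm, mpow,
    cfc_starAlgHom_prod _ _ (hherm C D) (hherm X Y),
    cfc_starAlgHom_prod _ f (cfc_predicate _ _ : IsSelfAdjoint _).isHermitian
      (cfc_predicate _ _ : IsSelfAdjoint _).isHermitian] at key
  unfold loewnerLE at key ⊢
  have hcorner := key.submatrix (finSumFinEquiv ∘ Sum.inl)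
  convert hcorner using 1
  ext i j
  simp [blockConj_apply, mpow]
end

section
/- Let p > 0, K ⊆ ℝ⁺ a p-convex interval with 0 ∈ K, f a nonnegative continuous function on K with f(0) = 0, and h a nonnegative non-zero super-multiplicative function on an interval J ⊆ ℝ⁺ containing (0,1) satisfying 2 h(1/2) ≤ h(α)/α for all α ∈ (0,1). If f is operator (p,h)-convex on K, then for any natural number k, any positive semidefinite operators A₁, …, A_k on a finite-dimensional Hilbert space H and coefficients α₁, …, α_k ∈ (0,1) with Σᵢ αᵢ Aᵢ = I_H, and any x₁, …, x_k ∈ K, one has f([Σᵢ αᵢ xᵢ^p Aᵢ]^{1/p}) ≤ Σᵢ h(αᵢ) f(xᵢ) Aᵢ. -/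
open Matrix
open scoped ComplexOrder

/-- If `M * C = C * N`, then `q(M) * C = C * q(N)` for every polynomial `q`. -/
theorem aeval_mul_eq_mul_aeval {m n : ℕ} {M : Matrix (Fin m) (Fin m) ℂ}
    {N : Matrix (Fin n) (Fin n) ℂ} {C : Matrix (Fin m) (Fin n) ℂ} (hMN : M * C = C * N)
    (q : Polynomial ℝ) : Polynomial.aeval M q * C = C * Polynomial.aeval N q := by
  induction q using Polynomial.induction_on' with
  | add a b ha hb => simp [Matrix.add_mul, Matrix.mul_add, ha, hb]
  | monomial d a =>
    have hpow : M ^ d * C = C * N ^ d := by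
      induction d with
      | zero => simp
      | succ d ih => rw [pow_succ, Matrix.mul_assoc, hMN, ← Matrix.mul_assoc, ih, Matrix.mul_assoc,
          pow_succ]
    simp [Polynomial.aeval_monomial, Algebra.algebraMap_eq_smul_one, hpow]

/-- On a finite set, a function agrees with a polynomial. -/
theorem exists_polynomial_eqOn {s : Set ℝ} (hs : s.Finite) (f : ℝ → ℝ) :
    ∃ q : Polynomial ℝ, s.EqOn f q.eval := by
  refine ⟨Lagrange.interpolate hs.toFinset id f, fun y hy => ?_⟩
  exact (Lagrange.eval_interpolate_at_node (v := id) f Function.injective_id.injOn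
    (hs.mem_toFinset.mpr hy)).symm

theorem cfc_eq_aeval_of_eqOn {n : ℕ} {M : Matrix (Fin n) (Fin n) ℂ} (hM : IsSelfAdjoint M)
    {f : ℝ → ℝ} {q : Polynomial ℝ} (hq : (spectrum ℝ M).EqOn f q.eval) :
    cfc f M = Polynomial.aeval M q := by
  rw [cfc_congr hq, cfc_polynomial q M]

theorem cfc_mul_eq_mul_cfc {m n : ℕ} {M : Matrix (Fin m) (Fin m) ℂ}
    {N : Matrix (Fin n) (Fin n) ℂ} {C : Matrix (Fin m) (Fin n) ℂ} (hM : IsSelfAdjoint M)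
    (hN : IsSelfAdjoint N) (hMN : M * C = C * N) (f : ℝ → ℝ) :
    cfc f M * C = C * cfc f N := by
  obtain ⟨q, hq⟩ := exists_polynomial_eqOn
    ((Matrix.finite_real_spectrum (A := M)).union (Matrix.finite_real_spectrum (A := N))) f
  rw [cfc_eq_aeval_of_eqOn hM (hq.mono Set.subset_union_left),
    cfc_eq_aeval_of_eqOn hN (hq.mono Set.subset_union_right), aeval_mul_eq_mul_aeval hMN]

theorem isSelfAdjoint_diagonal_ofReal {n : ℕ} (d : Fin n → ℝ) :
    IsSelfAdjoint (diagonal fun i => (d i : ℂ)) := by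
  change (diagonal fun i => (d i : ℂ))ᴴ = _
  simp [diagonal_conjTranspose, Pi.star_def]

theorem spectrum_diagonal_ofReal_subset {n : ℕ} (d : Fin n → ℝ) :
    spectrum ℝ (diagonal fun i => (d i : ℂ)) ⊆ Set.range d := by
  intro r hr
  by_contra hcon
  refine hr ?_
  have : algebraMap ℝ (Matrix (Fin n) (Fin n) ℂ) r - diagonal (fun i => (d i : ℂ))
      = diagonal fun i => ((r - d i : ℝ) : ℂ) := by
    ext i j
    by_cases hij : i = j <;> simp [Matrix.algebraMap_matrix_apply, hij]
  rw [spectrum.mem_resolventSet_iff, this, isUnit_diagonal, Pi.isUnit_iff]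
  intro i
  rw [isUnit_iff_ne_zero, Complex.ofReal_ne_zero, sub_ne_zero]
  exact fun h => hcon ⟨i, h.symm⟩

theorem cfc_diagonal_ofReal {n : ℕ} (d : Fin n → ℝ) (f : ℝ → ℝ) :
    cfc f (diagonal fun i => (d i : ℂ)) = diagonal fun i => (f (d i) : ℂ) := by
  obtain ⟨q, hq⟩ := exists_polynomial_eqOn (Set.finite_range d) f
  rw [cfc_eq_aeval_of_eqOn (isSelfAdjoint_diagonal_ofReal d)
    (hq.mono (spectrum_diagonal_ofReal_subset d))]
  have hd := Polynomial.aeval_algHom_apply (Matrix.diagonalAlgHom (n := Fin n) (α := ℂ) ℝ)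
    (fun i => (d i : ℂ)) q
  simp only [Matrix.diagonalAlgHom_apply] at hd
  rw [hd]
  congr 1
  ext i
  rw [Polynomial.aeval_pi_apply₂, hq ⟨i, rfl⟩]
  exact Polynomial.aeval_algebraMap_apply_eq_algebraMap_eval (d i) q

/-- Compression inequality: for an isometry `C` and a real diagonal matrix `D = diag d`,
`f([C* D^p C]^{1/p}) ≤ 2 h(1/2) C* f(D) C`. -/
theorem OperatorPHConvexOn.compression_le {p : ℝ} {K : Set ℝ} {h f : ℝ → ℝ}
    (hf : OperatorPHConvexOn p K h f) (hK : K ⊆ Set.Ici 0) {m n : ℕ}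
    {C : Matrix (Fin m) (Fin n) ℂ} (hC : Cᴴ * C = 1) {d : Fin m → ℝ} (hd : ∀ i, d i ∈ K) :
    loewnerLE (cfc f (mpow (Cᴴ * diagonal (fun i => ((d i ^ p : ℝ) : ℂ)) * C) (1 / p)))
      ((2 * h (1 / 2)) • (Cᴴ * diagonal (fun i => (f (d i) : ℂ)) * C)) := by
  set D : Matrix (Fin m) (Fin m) ℂ := diagonal fun i => (d i : ℂ)
  set S : Matrix (Fin m) (Fin m) ℂ := (2 : ℝ) • (C * Cᴴ) - 1 with hS
  have hSC : S * C = C := by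
    rw [hS, Matrix.sub_mul, Matrix.smul_mul, Matrix.mul_assoc, hC, Matrix.mul_one, Matrix.one_mul,
      two_smul, add_sub_cancel_right]
  have hSH : Sᴴ = S := by simp [hS]
  have hSS : S * S = 1 := by
    nth_rewrite 2 [hS]
    rw [Matrix.mul_sub, Matrix.mul_smul, ← Matrix.mul_assoc, hSC, Matrix.mul_one, hS]
    abel
  have hCS : Cᴴ * S = Cᴴ := by
    simpa [hSH] using congrArg conjTranspose hSC
  have hDsa : IsSelfAdjoint D := isSelfAdjoint_diagonal_ofReal d
  have hDpos : D.PosSemidef := by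
    refine PosSemidef.diagonal fun i => ?_
    exact Complex.zero_le_real.mpr (hK (hd i))
  have hSDSpos : (S * D * S).PosSemidef := by
    simpa [hSH] using hDpos.conjTranspose_mul_mul_same S
  have hSpec : spectrum ℝ D ⊆ K :=
    (spectrum_diagonal_ofReal_subset d).trans (Set.range_subset_iff.mpr hd)
  have hSpecS : spectrum ℝ (S * D * S) ⊆ K := by
    let u : (Matrix (Fin m) (Fin m) ℂ)ˣ := ⟨S, S, hSS, hSS⟩
    have := spectrum.units_conjugate (R := ℝ) (a := D) (u := u)
    exact this.trans_subset hSpec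
  have hconj (g : ℝ → ℝ) : cfc g (S * D * S) = S * cfc g D * S := by
    have := cfc_mul_eq_mul_cfc (C := S) hSDSpos.isHermitian hDsa
      (by rw [Matrix.mul_assoc, hSS, Matrix.mul_one]) g
    rw [← this, Matrix.mul_assoc _ S S, hSS, Matrix.mul_one]
  have key := hf.2.2 m D (S * D * S) hDpos hSDSpos hSpec hSpecS (1 / 2) (by norm_num)
  have hhalf : (1 - 1 / 2 : ℝ) = 1 / 2 := by norm_num
  have hdiag : ∀ g : ℝ → ℝ, cfc g D = diagonal fun i => (g (d i) : ℂ) := cfc_diagonal_ofReal d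
  simp only [mpow, hhalf, hconj, hdiag] at key
  set E : Matrix (Fin m) (Fin m) ℂ := diagonal fun i => ((d i ^ p : ℝ) : ℂ)
  set G : Matrix (Fin m) (Fin m) ℂ := diagonal fun i => (f (d i) : ℂ)
  have hEsa : Eᴴ = E := isSelfAdjoint_diagonal_ofReal fun i => d i ^ p
  have hMsa : IsSelfAdjoint ((1 / 2 : ℝ) • E + (1 / 2 : ℝ) • (S * E * S)) := by
    change (_)ᴴ = _
    simp [hEsa, hSH, Matrix.mul_assoc]
  have hNsa : IsSelfAdjoint (Cᴴ * E * C) := by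
    change (_)ᴴ = _
    simp [hEsa, Matrix.mul_assoc]
  have hMN : ((1 / 2 : ℝ) • E + (1 / 2 : ℝ) • (S * E * S)) * C = C * (Cᴴ * E * C) := by
    rw [Matrix.add_mul, Matrix.smul_mul, Matrix.smul_mul, Matrix.mul_assoc _ S C, hSC, hS,
      Matrix.mul_assoc _ E C, Matrix.sub_mul, Matrix.one_mul, smul_sub, Matrix.smul_mul, smul_smul]
    norm_num [Matrix.mul_assoc]
  have hfMN := cfc_mul_eq_mul_cfc (cfc_predicate _ _) (cfc_predicate _ _)
    (cfc_mul_eq_mul_cfc hMsa hNsa hMN fun y => y ^ (1 / p)) f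
  have hcomp := PosSemidef.conjTranspose_mul_mul_same key C
  have hG : Cᴴ * (S * G * S) * C = Cᴴ * G * C := by
    rw [← Matrix.mul_assoc, ← Matrix.mul_assoc, hCS, Matrix.mul_assoc, hSC]
  rw [Matrix.mul_sub, Matrix.sub_mul, Matrix.mul_assoc _ (cfc f _) C, hfMN, ← Matrix.mul_assoc, hC,
    Matrix.one_mul, Matrix.mul_add, Matrix.add_mul, Matrix.mul_smul, Matrix.mul_smul,
    Matrix.smul_mul, Matrix.smul_mul, hG, ← two_smul ℝ, smul_smul] at hcomp
  exact hcomp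

/-- The block column matrix with blocks `B i`. -/
def blockColumn {k n : ℕ} (B : Fin k → Matrix (Fin n) (Fin n) ℂ) :
    Matrix (Fin (k * n)) (Fin n) ℂ :=
  of fun a j => B (finProdFinEquiv.symm a).1 (finProdFinEquiv.symm a).2 j

theorem conjTranspose_blockColumn_mul_diagonal_mul {k n : ℕ}
    (B : Fin k → Matrix (Fin n) (Fin n) ℂ) (t : Fin k → ℝ) :
    (blockColumn B)ᴴ * diagonal (fun a : Fin (k * n) => (t (finProdFinEquiv.symm a).1 : ℂ)) * blockColumn B
      = ∑ i, t i • ((B i)ᴴ * B i) := by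
  ext r s
  rw [Matrix.mul_apply, ← finProdFinEquiv.sum_comp, Fintype.sum_prod_type, Matrix.sum_apply]
  refine Finset.sum_congr rfl fun i _ => ?_
  rw [Matrix.smul_apply, Matrix.mul_apply, Finset.smul_sum]
  refine Finset.sum_congr rfl fun j _ => ?_
  simp only [mul_diagonal, blockColumn, conjTranspose_apply, of_apply, Equiv.symm_apply_apply,
    Complex.real_smul]
  ring

/-- If `f` is operator `(p,h)`-convex on `K`, then for positive semidefinite operators
`A₁, …, A_k` (on a finite-dimensional Hilbert space, modelled as matrices) and
`α₁, …, α_k ∈ (0,1)` with `∑ αᵢ Aᵢ = I`, and any `x₁, …, x_k ∈ K`,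
`f([∑ αᵢ xᵢ^p Aᵢ]^{1/p}) ≤ ∑ h(αᵢ) f(xᵢ) Aᵢ`. -/
theorem stmt14 (p : ℝ) (hp : 0 < p) (K : Set ℝ) (hK : K ⊆ Set.Ici 0) (hKI : K.OrdConnected)
    (hKp : PConvex p K) (h0K : (0 : ℝ) ∈ K)
    (J : Set ℝ) (hJ : Set.Ioo (0 : ℝ) 1 ⊆ J) (hJpos : J ⊆ Set.Ici 0)
    (h : ℝ → ℝ) (hh0 : ∀ x ∈ J, 0 ≤ h x) (hhne : ∃ x ∈ J, h x ≠ 0)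
    (hsm : SuperMultiplicativeOn J h)
    (h2h : ∀ α ∈ Set.Ioo (0 : ℝ) 1, 2 * h (1 / 2) ≤ h α / α)
    (f : ℝ → ℝ) (hf0 : f 0 = 0) (hf : OperatorPHConvexOn p K h f)
    (k n : ℕ) (A : Fin k → Matrix (Fin n) (Fin n) ℂ) (α : Fin k → ℝ) (x : Fin k → ℝ)
    (hA : ∀ i, (A i).PosSemidef) (hα : ∀ i, α i ∈ Set.Ioo (0 : ℝ) 1)
    (hx : ∀ i, x i ∈ K) (hsum : ∑ i, α i • A i = 1) :
    loewnerLE (cfc f (mpow (∑ i, (α i * x i ^ p) • A i) (1 / p)))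
      (∑ i, (h (α i) * f (x i)) • A i) := by
  open scoped MatrixOrder Matrix.Norms.L2Operator in
  choose B hB using fun i =>
    CStarAlgebra.nonneg_iff_eq_star_mul_self.mp ((hA i).smul (hα i).1.le).nonneg
  simp only [star_eq_conjTranspose] at hB
  have hC : (blockColumn B)ᴴ * blockColumn B = 1 := by
    have := conjTranspose_blockColumn_mul_diagonal_mul B fun _ => 1
    simpa [← hB, hsum] using this
  have key := hf.compression_le hK hC (d := fun a => x (finProdFinEquiv.symm a).1) fun _ => hx _
  rw [conjTranspose_blockColumn_mul_diagonal_mul B fun i => x i ^ p,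
    conjTranspose_blockColumn_mul_diagonal_mul B fun i => f (x i)] at key
  simp only [← hB, smul_smul, Finset.smul_sum] at key
  simp only [mul_comm (α _)]
  have hle : (∑ i, (h (α i) * f (x i)) • A i
      - ∑ i, (2 * h (1 / 2) * (f (x i) * α i)) • A i).PosSemidef := by
    rw [← Finset.sum_sub_distrib]
    refine posSemidef_sum _ fun i _ => ?_
    rw [← sub_smul]
    refine (hA i).smul ?_
    have h1 := (le_div_iff₀ (hα i).1).mp (h2h _ (hα i))
    nlinarith [mul_le_mul_of_nonneg_right h1 (hf.1 _ (hx i))]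
  have := hle.add key
  rwa [sub_add_sub_cancel] at this
end

section
/- Let p > 0, K ⊆ ℝ⁺ a p-convex interval with 0 ∈ K, f a nonnegative continuous function on K with f(0) = 0, and h a nonnegative non-zero super-multiplicative function on an interval J ⊆ ℝ⁺ containing (0,1) satisfying 2 h(1/2) ≤ h(α)/α for all α ∈ (0,1). Suppose that for any natural number k, any positive semidefinite operators A₁, …, A_k on a finite-dimensional Hilbert space H and coefficients α₁, …, α_k ∈ (0,1) with Σᵢ αᵢ Aᵢ = I_H, and any x₁, …, x_k ∈ K, one has f([Σᵢ αᵢ xᵢ^p Aᵢ]^{1/p}) ≤ Σᵢ h(αᵢ) f(xᵢ) Aᵢ. Then f is operator (p,h)-convex on K. -/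
open Matrix
open scoped ComplexOrder

/-- Spectral decomposition of a Hermitian matrix into rank-one projections, compatible with the
continuous functional calculus. -/
theorem Matrix.IsHermitian.exists_cfc_eq_sum {n : ℕ} {A : Matrix (Fin n) (Fin n) ℂ}
    (hA : A.IsHermitian) :
    ∃ (P : Fin n → Matrix (Fin n) (Fin n) ℂ) (a : Fin n → ℝ), (∀ i, (P i).PosSemidef) ∧
      (∀ i, a i ∈ spectrum ℝ A) ∧ ∑ i, P i = 1 ∧ ∀ g : ℝ → ℝ, cfc g A = ∑ i, g (a i) • P i := by
  set U : Matrix (Fin n) (Fin n) ℂ := (hA.eigenvectorUnitary : Matrix (Fin n) (Fin n) ℂ) with hU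
  have key : ∀ d : Fin n → ℝ, U * diagonal (fun i => (d i : ℂ)) * star U =
      ∑ i, d i • (U * single i i 1 * star U) := by
    intro d
    have hd : diagonal (fun i => (d i : ℂ)) = ∑ i, d i • single i i (1 : ℂ) := by
      rw [← sum_single_eq_diagonal]
      simp [smul_single]
    rw [hd, Finset.mul_sum, Finset.sum_mul]
    simp only [mul_smul_comm, smul_mul_assoc]
  refine ⟨fun i => U * single i i 1 * star U, hA.eigenvalues, fun i => ?_,
    fun i => hA.eigenvalues_mem_spectrum_real i, ?_, fun g => ?_⟩
  · have hs : (single i i (1 : ℂ)).PosSemidef := by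
      rw [← diagonal_single]
      exact PosSemidef.diagonal (Pi.single_nonneg.2 zero_le_one)
    exact hs.mul_mul_conjTranspose_same U
  · have h1 := key 1
    simp only [Pi.one_apply, one_smul, Complex.ofReal_one, diagonal_one, mul_one] at h1
    rw [← h1]
    exact Unitary.coe_mul_star_self _
  · rw [hA.cfc_eq, IsHermitian.cfc, ← key]
    rfl

/-- Converse: if for all `k`, all positive semidefinite operators `A₁, …, A_k` (on a
finite-dimensional Hilbert space, modelled as matrices) and `α₁, …, α_k ∈ (0,1)` with
`∑ αᵢ Aᵢ = I`, and all `x₁, …, x_k ∈ K` one has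
`f([∑ αᵢ xᵢ^p Aᵢ]^{1/p}) ≤ ∑ h(αᵢ) f(xᵢ) Aᵢ`, then `f` is operator `(p,h)`-convex. -/
theorem stmt15 (p : ℝ) (hp : 0 < p) (K : Set ℝ) (hK : K ⊆ Set.Ici 0) (hKI : K.OrdConnected)
    (hKp : PConvex p K) (h0K : (0 : ℝ) ∈ K)
    (J : Set ℝ) (hJ : Set.Ioo (0 : ℝ) 1 ⊆ J) (hJpos : J ⊆ Set.Ici 0)
    (h : ℝ → ℝ) (hh0 : ∀ x ∈ J, 0 ≤ h x) (hhne : ∃ x ∈ J, h x ≠ 0)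
    (hsm : SuperMultiplicativeOn J h)
    (h2h : ∀ α ∈ Set.Ioo (0 : ℝ) 1, 2 * h (1 / 2) ≤ h α / α)
    (f : ℝ → ℝ) (hfnn : ∀ x ∈ K, 0 ≤ f x) (hfc : ContinuousOn f K) (hf0 : f 0 = 0)
    (hyp : ∀ (k n : ℕ) (A : Fin k → Matrix (Fin n) (Fin n) ℂ) (α : Fin k → ℝ)
      (x : Fin k → ℝ), (∀ i, (A i).PosSemidef) → (∀ i, α i ∈ Set.Ioo (0 : ℝ) 1) →
      (∀ i, x i ∈ K) → (∑ i, α i • A i = 1) →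
      loewnerLE (cfc f (mpow (∑ i, (α i * x i ^ p) • A i) (1 / p)))
        (∑ i, (h (α i) * f (x i)) • A i)) :
    OperatorPHConvexOn p K h f := by
  refine ⟨hfnn, hfc, fun n A B hA hB hAK hBK α hα => ?_⟩
  obtain ⟨P, a, hP, ha, hP1, hPc⟩ := hA.isHermitian.exists_cfc_eq_sum
  obtain ⟨Q, b, hQ, hb, hQ1, hQc⟩ := hB.isHermitian.exists_cfc_eq_sum
  have hα' : 1 - α ∈ Set.Ioo (0 : ℝ) 1 := ⟨by linarith [hα.2], by linarith [hα.1]⟩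
  have hsum := hyp (n + n) n (Fin.append P Q) (Fin.append (fun _ => α) fun _ => 1 - α)
    (Fin.append a b)
    (fun i => by
      refine Fin.addCases (fun j => ?_) (fun j => ?_) i
      · rw [Fin.append_left]; exact hP j
      · rw [Fin.append_right]; exact hQ j)
    (fun i => by
      refine Fin.addCases (fun j => ?_) (fun j => ?_) i
      · rwa [Fin.append_left]
      · rwa [Fin.append_right])
    (fun i => by
      refine Fin.addCases (fun j => ?_) (fun j => ?_) i
      · rw [Fin.append_left]; exact hAK (ha j)
      · rw [Fin.append_right]; exact hBK (hb j))
    (by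
      simp only [Fin.sum_univ_add, Fin.append_left, Fin.append_right, ← Finset.smul_sum, hP1, hQ1,
        ← add_smul, add_sub_cancel, one_smul])
  simp only [Fin.sum_univ_add, Fin.append_left, Fin.append_right, mul_smul,
    ← Finset.smul_sum, ← hPc, ← hQc] at hsum
  simpa only [mpow, hPc, hQc] using hsum
end
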